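/- Let n ≥ 3. The function μ(α) := ∫₁^∞ s (W(s, α) − c_*) ds is strictly increasing in α on (γ₀, +∞), and μ(α) → +∞ as α → +∞. -/

import Mathlib

open Set Filter MeasureTheory

/-- The vector `(β, γ, …, γ) ∈ ℝⁿ`: first coordinate `β`, all remaining coordinates `γ`. -/
def vec (n : ℕ) (β γ : ℝ) : Fin n → ℝ := fun j => if (j : ℕ) = 0 then β else γ

/-- `w` is a `C¹` solution on `[1, ∞)` of the ODE `dW/dr = (g(W) - W)/r` with `w 1 = a`,
taking values in `(γ₀, ∞)`. -/
def IsSolW (g : ℝ → ℝ) (γ₀ a : ℝ) (w : ℝ → ℝ) : Prop :=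
  ContDiffOn ℝ 1 w (Set.Ici 1) ∧ w 1 = a ∧ (∀ r ∈ Set.Ici (1 : ℝ), γ₀ < w r) ∧
    ∀ r ∈ Set.Ici (1 : ℝ), HasDerivWithinAt w ((g (w r) - w r) / r) (Set.Ici 1) r

/-- Comparison principle: two solutions on `[1, ∞)` of `du/dr = φ u / r` with `φ` antitone stay
ordered if they are ordered at `1`. -/
theorem le_of_hasDerivWithinAt_antitoneOn {φ u v : ℝ → ℝ} {s : Set ℝ} (hφ : AntitoneOn φ s)
    (hus : ∀ r ∈ Ici (1 : ℝ), u r ∈ s) (hvs : ∀ r ∈ Ici (1 : ℝ), v r ∈ s)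
    (hu : ∀ r ∈ Ici (1 : ℝ), HasDerivWithinAt u (φ (u r) / r) (Ici 1) r)
    (hv : ∀ r ∈ Ici (1 : ℝ), HasDerivWithinAt v (φ (v r) / r) (Ici 1) r)
    (h1 : u 1 ≤ v 1) : ∀ r ∈ Ici (1 : ℝ), u r ≤ v r := by
  intro r₀ hr₀
  by_contra! hlt
  have huc : ContinuousOn u (Ici 1) := fun r hr => (hu r hr).continuousWithinAt
  have hvc : ContinuousOn v (Ici 1) := fun r hr => (hv r hr).continuousWithinAt
  have hsub : Icc 1 r₀ ⊆ Ici (1 : ℝ) := Icc_subset_Ici_self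
  have hclosed : IsClosed {r ∈ Icc 1 r₀ | u r ≤ v r} :=
    isClosed_Icc.isClosed_le (huc.mono hsub) (hvc.mono hsub)
  have hcompact : IsCompact {r ∈ Icc 1 r₀ | u r ≤ v r} :=
    isCompact_Icc.of_isClosed_subset hclosed (sep_subset _ _)
  obtain ⟨t, ⟨⟨ht1, htr⟩, hut⟩, hmax⟩ :=
    hcompact.exists_isGreatest ⟨1, ⟨le_refl _, hr₀⟩, h1⟩
  have hsub' : Icc t r₀ ⊆ Ici (1 : ℝ) := fun r hr => ht1.trans hr.1
  have hanti : AntitoneOn (fun r => u r - v r) (Icc t r₀) := by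
    refine antitoneOn_of_hasDerivWithinAt_nonpos (convex_Icc _ _)
      (f' := fun r => φ (u r) / r - φ (v r) / r)
      ((huc.mono hsub').sub (hvc.mono hsub')) ?_ ?_
    · intro r hr
      have hr1 := hsub' (interior_subset hr)
      exact ((hu r hr1).sub (hv r hr1)).mono (interior_subset.trans hsub')
    · intro r hr
      have hr1 := hsub' (interior_subset hr)
      rw [interior_Icc] at hr
      have hvu : v r < u r := by
        by_contra! h
        exact absurd (hmax ⟨⟨hr1, hr.2.le⟩, h⟩) (not_le.2 hr.1)
      have hr0 : (0 : ℝ) < r := lt_of_lt_of_le one_pos hr1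
      rw [← sub_div]
      exact div_nonpos_of_nonpos_of_nonneg
        (sub_nonpos.2 (hφ (hvs r hr1) (hus r hr1) hvu.le)) hr0.le
  have := hanti ⟨le_refl _, htr⟩ ⟨htr, le_refl _⟩ htr
  simp only at this
  linarith

/-- If `dw/dr = φ w / r` on `[1, ∞)` with `0 ≤ φ w + n * w`, then `r ^ n * w r` stays above `w 1`. -/
theorem le_pow_mul_of_hasDerivWithinAt {φ w : ℝ → ℝ} (n : ℕ)
    (hw : ∀ r ∈ Ici (1 : ℝ), HasDerivWithinAt w (φ (w r) / r) (Ici 1) r)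
    (hφ : ∀ r ∈ Ici (1 : ℝ), 0 ≤ φ (w r) + n * w r) :
    ∀ r ∈ Ici (1 : ℝ), w 1 ≤ r ^ n * w r := by
  have hder : ∀ r ∈ Ici (1 : ℝ), HasDerivWithinAt (fun r => r ^ n * w r)
      (n * r ^ (n - 1) * w r + r ^ n * (φ (w r) / r)) (Ici 1) r := fun r hr =>
    (hasDerivAt_pow n r).hasDerivWithinAt.mul (hw r hr)
  have hmono : MonotoneOn (fun r => r ^ n * w r) (Ici 1) := by
    refine monotoneOn_of_hasDerivWithinAt_nonneg (convex_Ici 1)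
      (fun r hr => (hder r hr).continuousWithinAt)
      (fun r hr => (hder r (interior_subset hr)).mono interior_subset) ?_
    intro r hr
    have hr1 := interior_subset hr
    have hr0 : (0 : ℝ) < r := lt_of_lt_of_le one_pos hr1
    have hpow : (n : ℝ) * r ^ (n - 1) = n * (r ^ n / r) := by
      rcases n with _ | n
      · simp
      · rw [Nat.add_sub_cancel, pow_succ, mul_div_cancel_right₀ _ hr0.ne']
    have heq : n * r ^ (n - 1) * w r + r ^ n * (φ (w r) / r)
        = r ^ n / r * (φ (w r) + n * w r) := by
      rw [hpow]
      ring
    rw [heq]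
    exact mul_nonneg (by positivity) (hφ r hr1)
  intro r hr
  simpa using hmono (mem_Ici.2 le_rfl) hr hr

/-- A nonnegative integrable function on `(a, ∞)` that is at least `c` on `(a, a + δ]` has
integral at least `δ * c`. -/
theorem mul_le_setIntegral_Ioi {F : ℝ → ℝ} {a c δ : ℝ} (hδ : 0 ≤ δ)
    (hF : IntegrableOn F (Ioi a)) (hnn : ∀ s ∈ Ioi a, 0 ≤ F s)
    (hc : ∀ s ∈ Ioc a (a + δ), c ≤ F s) : δ * c ≤ ∫ s in Ioi a, F s := by
  have hsub : Ioc a (a + δ) ⊆ Ioi a := Ioc_subset_Ioi_self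
  calc δ * c = ∫ _ in Ioc a (a + δ), c := by simp [hδ]
    _ ≤ ∫ s in Ioc a (a + δ), F s :=
      setIntegral_mono_on (by simp) (hF.mono_set hsub) measurableSet_Ioc hc
    _ ≤ ∫ s in Ioi a, F s :=
      setIntegral_mono_set hF ((ae_restrict_mem measurableSet_Ioi).mono hnn)
        hsub.eventuallyLE

/-- A function with positive partial derivatives on a convex cone containing the positive
orthant strictly increases along every strictly positive direction. -/
theorem lt_apply_add_of_fderiv_single_pos {n : ℕ} (hn : 0 < n) {Γ : Set (Fin n → ℝ)}
    (hΓopen : IsOpen Γ) (hΓconv : Convex ℝ Γ)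
    (hΓcone : ∀ x ∈ Γ, ∀ t : ℝ, 0 < t → t • x ∈ Γ)
    (hΓ1 : {x : Fin n → ℝ | ∀ j, 0 < x j} ⊆ Γ) {f : (Fin n → ℝ) → ℝ}
    (hf : DifferentiableOn ℝ f Γ)
    (hfmono : ∀ x ∈ Γ, ∀ j : Fin n, 0 < fderiv ℝ f x (Pi.single j 1))
    {x y : Fin n → ℝ} (hx : x ∈ Γ) (hy : ∀ j, 0 < y j) : f x < f (x + y) := by
  have hadd : ∀ a ∈ Γ, ∀ b ∈ Γ, a + b ∈ Γ := by
    intro a ha b hb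
    have := hΓcone _ (hΓconv ha hb (a := 1 / 2) (b := 1 / 2)
      (by norm_num) (by norm_num) (by norm_num)) 2 two_pos
    simpa [smul_smul] using this
  have hmem : ∀ t ∈ Icc (0 : ℝ) 1, x + t • y ∈ Γ := by
    intro t ht
    rcases ht.1.eq_or_lt with rfl | h0
    · simpa using hx
    · exact hadd x hx _ (hΓcone y (hΓ1 hy) t h0)
  have hder : ∀ t ∈ Icc (0 : ℝ) 1,
      HasDerivAt (fun t : ℝ => f (x + t • y)) (fderiv ℝ f (x + t • y) y) t := by
    intro t ht
    have hfd : HasFDerivAt f (fderiv ℝ f (x + t • y)) (x + t • y) :=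
      (hf.differentiableAt (hΓopen.mem_nhds (hmem t ht))).hasFDerivAt
    have hline : HasDerivAt (fun t : ℝ => x + t • y) y t := by
      simpa using ((hasDerivAt_id t).smul_const y).const_add x
    exact hfd.comp_hasDerivAt t hline
  have hpos : ∀ t ∈ Icc (0 : ℝ) 1, 0 < fderiv ℝ f (x + t • y) y := by
    intro t ht
    have : Nonempty (Fin n) := ⟨⟨0, hn⟩⟩
    rw [← ContinuousLinearMap.coe_coe, LinearMap.pi_apply_eq_sum_univ]
    refine Finset.sum_pos (fun j _ => ?_) Finset.univ_nonempty
    have hsingle : (fun i => if j = i then (1 : ℝ) else 0) = Pi.single j 1 := by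
      ext i
      simp [Pi.single_apply, eq_comm]
    rw [hsingle]
    exact mul_pos (hy j) (hfmono _ (hmem t ht) j)
  have hstrict : StrictMonoOn (fun t : ℝ => f (x + t • y)) (Icc 0 1) := by
    refine strictMonoOn_of_hasDerivWithinAt_pos (convex_Icc 0 1)
      (fun t ht => (hder t ht).continuousAt.continuousWithinAt)
      (fun t ht => (hder t (interior_subset ht)).hasDerivWithinAt)
      (fun t ht => hpos t (interior_subset ht))
  simpa using hstrict (left_mem_Icc.2 zero_le_one) (right_mem_Icc.2 zero_le_one) zero_lt_one

theorem sum_vec {n : ℕ} (hn : 0 < n) (β γ : ℝ) : ∑ j, vec n β γ j = β + (n - 1) * γ := by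
  obtain ⟨m, rfl⟩ := Nat.exists_eq_succ_of_ne_zero hn.ne'
  rw [Fin.sum_univ_succ]
  simp [vec]

/-- For `n ≥ 3`, the function `μ(α) = ∫₁^∞ s (W(s, α) − c_*) ds` is strictly increasing
on `(γ₀, ∞)`, and `μ(α) → +∞` as `α → +∞`. -/
theorem stmt16 (n : ℕ) (hn : 3 ≤ n)
    (Γ : Set (Fin n → ℝ))
    (hΓopen : IsOpen Γ)
    (hΓconv : Convex ℝ Γ)
    (hΓcone : ∀ x ∈ Γ, ∀ t : ℝ, 0 < t → t • x ∈ Γ)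
    (hΓsym : ∀ σ : Equiv.Perm (Fin n), ∀ x ∈ Γ, (x ∘ σ) ∈ Γ)
    (hΓ1 : {x : Fin n → ℝ | ∀ j, 0 < x j} ⊆ Γ)
    (hΓ2 : Γ ⊆ {x : Fin n → ℝ | 0 < ∑ j, x j})
    (f : (Fin n → ℝ) → ℝ)
    (hfsmooth : ContDiffOn ℝ (⊤ : ℕ∞) f Γ)
    (hfcont : ContinuousOn f (closure Γ))
    (hfsym : ∀ σ : Equiv.Perm (Fin n), ∀ x : Fin n → ℝ, f (x ∘ σ) = f x)
    (hfconc : ConcaveOn ℝ Γ f)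
    (hfpos : ∀ x ∈ Γ, 0 < f x)
    (hfbd : ∀ x ∈ frontier Γ, f x = 0)
    (hfmono : ∀ x ∈ Γ, ∀ j : Fin n, 0 < fderiv ℝ f x (Pi.single j 1))
    (cstar : ℝ) (hcstar : 0 < cstar)
    (hfcstar : f (fun _ => cstar) = 1)
    (γ₀ : ℝ)
    (hγ₀ : γ₀ = sInf {γ : ℝ | 0 < γ ∧ ∃ β : ℝ, vec n β γ ∈ Γ ∧ f (vec n β γ) = 1})
    (hγ₀0 : 0 ≤ γ₀) (hγ₀cstar : γ₀ < cstar)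
    (g : ℝ → ℝ)
    (hg : ∀ γ ∈ Set.Ioi γ₀, vec n (g γ) γ ∈ Γ ∧ f (vec n (g γ) γ) = 1)
    (hgu : ∀ γ ∈ Set.Ioi γ₀, ∀ β : ℝ, vec n β γ ∈ Γ → f (vec n β γ) = 1 → β = g γ)
    (W : ℝ → ℝ → ℝ)
    (hW : ∀ α ∈ Set.Ioi γ₀, IsSolW g γ₀ α (W α))
    (hWint : ∀ α ∈ Set.Ioi γ₀, IntegrableOn (fun s : ℝ => s * (W α s - cstar)) (Set.Ioi 1)) :
    StrictMonoOn (fun α : ℝ => ∫ s in Set.Ioi (1 : ℝ), s * (W α s - cstar)) (Set.Ioi γ₀) ∧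
    Tendsto (fun α : ℝ => ∫ s in Set.Ioi (1 : ℝ), s * (W α s - cstar)) atTop atTop := by
  have hn0 : 0 < n := by omega
  have hf : DifferentiableOn ℝ f Γ := hfsmooth.differentiableOn (by simp)
  have hganti : AntitoneOn g (Ioi γ₀) := by
    intro a ha b hb hab
    rcases hab.eq_or_lt with rfl | hab
    · exact le_rfl
    by_contra! hlt
    have hlt' := lt_apply_add_of_fderiv_single_pos hn0 hΓopen hΓconv hΓcone hΓ1 hf hfmono
      (hg a ha).1 (y := vec n (g b) b - vec n (g a) a) (fun j => by
        by_cases hj : (j : ℕ) = 0 <;> simp [vec, hj, hab, hlt])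
    rw [add_sub_cancel, (hg a ha).2, (hg b hb).2] at hlt'
    exact lt_irrefl _ hlt'
  have hφanti : AntitoneOn (fun x => g x - x) (Ioi γ₀) := fun a ha b hb hab =>
    sub_le_sub (hganti ha hb hab) hab
  have hvec : vec n cstar cstar = fun _ => cstar := by
    ext j
    simp [vec]
  have hgc : cstar = g cstar :=
    hgu cstar hγ₀cstar cstar (hvec ▸ hΓ1 fun _ => hcstar) (hvec ▸ hfcstar)
  have hcomp : ∀ a ∈ Ioi γ₀, ∀ b ∈ Ioi γ₀, a ≤ b → ∀ r ∈ Ici (1 : ℝ), W a r ≤ W b r := by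
    intro a ha b hb hab
    obtain ⟨-, ha1, has, had⟩ := hW a ha
    obtain ⟨-, hb1, hbs, hbd⟩ := hW b hb
    exact le_of_hasDerivWithinAt_antitoneOn hφanti has hbs had hbd (by rwa [ha1, hb1])
  have hcompc : ∀ a ∈ Ioi γ₀, cstar ≤ a → ∀ r ∈ Ici (1 : ℝ), cstar ≤ W a r := by
    intro a ha hca
    obtain ⟨-, ha1, has, had⟩ := hW a ha
    refine le_of_hasDerivWithinAt_antitoneOn (u := fun _ => cstar) hφanti
      (fun _ _ => hγ₀cstar) has (fun r _ => ?_) had (by rwa [ha1])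
    rw [← hgc, sub_self, zero_div]
    exact hasDerivWithinAt_const _ _ _
  have hlower : ∀ a ∈ Ioi γ₀, ∀ r ∈ Ici (1 : ℝ), a ≤ r ^ n * W a r := by
    intro a ha
    obtain ⟨-, ha1, has, had⟩ := hW a ha
    have h := le_pow_mul_of_hasDerivWithinAt (φ := fun x => g x - x) n had (fun r hr => by
      have hsum : 0 < ∑ j, vec n (g (W a r)) (W a r) j := hΓ2 (hg _ (has r hr)).1
      rw [sum_vec hn0] at hsum
      linarith)
    rwa [ha1] at h
  constructor
  · intro a ha b hb hab
    obtain ⟨hac, ha1, -, -⟩ := hW a ha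
    obtain ⟨hbc, hb1, -, -⟩ := hW b hb
    have hcont : ContinuousWithinAt (fun r => W b r - W a r) (Ici 1) 1 :=
      (hbc.continuousOn.sub hac.continuousOn) 1 (mem_Ici.2 le_rfl)
    have hev : ∀ᶠ r in nhdsWithin (1 : ℝ) (Ici 1), (b - a) / 2 < W b r - W a r := by
      refine hcont.eventually_const_lt ?_
      simp only [ha1, hb1]
      linarith
    obtain ⟨u, hu1, hu⟩ := mem_nhdsGE_iff_exists_Icc_subset.1 hev
    have hu1 : 1 < u := hu1
    have hpos : (u - 1) * ((b - a) / 2) ≤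
        ∫ s in Ioi (1 : ℝ), (s * (W b s - cstar) - s * (W a s - cstar)) := by
      refine mul_le_setIntegral_Ioi (by linarith) ((hWint b hb).sub (hWint a ha)) ?_ ?_
      · intro s hs
        have hs1 : (1 : ℝ) < s := hs
        have := hcomp a ha b hb hab.le s hs1.le
        rw [← mul_sub]
        exact mul_nonneg (by linarith) (by linarith)
      · intro s hs
        have hs' : (b - a) / 2 < W b s - W a s := hu ⟨hs.1.le, by linarith [hs.2]⟩
        nlinarith [hs.1]
    rw [integral_sub (hWint b hb) (hWint a ha)] at hpos
    have : 0 < (u - 1) * ((b - a) / 2) :=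
      mul_pos (by linarith) (by linarith)
    simp only
    linarith
  · have hlim : Tendsto (fun α : ℝ => α / 2 ^ n - cstar) atTop atTop :=
      tendsto_atTop_add_const_right _ _ (tendsto_id.atTop_div_const (by positivity))
    refine tendsto_atTop_mono' _ ?_ hlim
    filter_upwards [eventually_ge_atTop cstar] with α hα
    have hαγ : α ∈ Ioi γ₀ := lt_of_lt_of_le hγ₀cstar hα
    have hnn := hcompc α hαγ hα
    have h := mul_le_setIntegral_Ioi (c := α / 2 ^ n - cstar) zero_le_one (hWint α hαγ)
      (fun s hs => mul_nonneg (by linarith [mem_Ioi.1 hs]) (sub_nonneg.2 (hnn s (mem_Ici.2 (mem_Ioi.1 hs).le))))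
      (fun s hs => by
        have hs1 : (1 : ℝ) ≤ s := hs.1.le
        have hs2 : s ≤ 2 := by linarith [hs.2]
        have hW0 := hnn s hs1
        have hle : α / 2 ^ n ≤ W α s := by
          rw [div_le_iff₀ (by positivity), mul_comm]
          refine (hlower α hαγ s hs1).trans ?_
          have := hcstar.le.trans hW0
          gcongr
        nlinarith)
    rwa [one_mul] at h
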